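/- arXiv:1204.4790 — 4 statements merged into one kernel-verified Lean document; each statement's English description precedes it below -/
import Mathlib

section
/- The rectangle–triangle mapping T(ξ,η) = ((1+ξ)(3−η)/8, (3−ξ)(1+η)/8) is a bijection from the open square 𝐐 = (−1,1)² onto the open triangle 𝐓 = {(x,y) : 0 < x, 0 < y, x + y < 1}, and its inverse is given explicitly, for (x,y) ∈ 𝐓, by ξ = 1 + (x−y) − √((x−y)² + 4(1−x−y)) and η = 1 − (x−y) − √((x−y)² + 4(1−x−y)). -/
noncomputable section

open Set

/-- The reference square 𝐐 = (−1,1)². -/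
def Qsq : Set (ℝ × ℝ) := Ioo (-1 : ℝ) 1 ×ˢ Ioo (-1 : ℝ) 1

/-- The reference triangle 𝐓 = {(x,y) : 0 < x, 0 < y, x + y < 1}. -/
def Tri : Set (ℝ × ℝ) := {p | 0 < p.1 ∧ 0 < p.2 ∧ p.1 + p.2 < 1}

/-- The rectangle–triangle mapping T(ξ,η) = ((1+ξ)(3−η)/8, (3−ξ)(1+η)/8). -/
def Tmap : ℝ × ℝ → ℝ × ℝ :=
  fun q => ((1 + q.1) * (3 - q.2) / 8, (3 - q.1) * (1 + q.2) / 8)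

/-- The explicit inverse formula:
ξ = 1 + (x−y) − √((x−y)² + 4(1−x−y)), η = 1 − (x−y) − √((x−y)² + 4(1−x−y)). -/
def Tinv : ℝ × ℝ → ℝ × ℝ :=
  fun p =>
    (1 + (p.1 - p.2) - Real.sqrt ((p.1 - p.2) ^ 2 + 4 * (1 - p.1 - p.2)),
     1 - (p.1 - p.2) - Real.sqrt ((p.1 - p.2) ^ 2 + 4 * (1 - p.1 - p.2)))

/-- The rectangle–triangle mapping is a bijection from 𝐐 onto 𝐓, with the explicit
inverse `Tinv`. -/
theorem rectangle_triangle_bijection :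
    Set.BijOn Tmap Qsq Tri ∧
    (∀ p ∈ Tri, Tinv p ∈ Qsq ∧ Tmap (Tinv p) = p) ∧
    (∀ q ∈ Qsq, Tinv (Tmap q) = q) := by
  have hA : ∀ p ∈ Tri, Tinv p ∈ Qsq ∧ Tmap (Tinv p) = p := by
    rintro ⟨x, y⟩ ⟨hx, hy, hxy⟩
    simp only at hx hy hxy
    have hD : 0 ≤ (x - y) ^ 2 + 4 * (1 - x - y) := by nlinarith [sq_nonneg (x - y)]
    have hs := Real.sq_sqrt hD
    have h1 : x - y < Real.sqrt ((x - y) ^ 2 + 4 * (1 - x - y)) :=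
      Real.lt_sqrt_of_sq_lt (by linarith)
    have h2 : -(x - y) < Real.sqrt ((x - y) ^ 2 + 4 * (1 - x - y)) :=
      Real.lt_sqrt_of_sq_lt (by rw [neg_sq]; linarith)
    have h3 : Real.sqrt ((x - y) ^ 2 + 4 * (1 - x - y)) < 2 + (x - y) := by
      rw [Real.sqrt_lt' (by linarith)]; nlinarith
    have h4 : Real.sqrt ((x - y) ^ 2 + 4 * (1 - x - y)) < 2 - (x - y) := by
      rw [Real.sqrt_lt' (by linarith)]; nlinarith
    simp only [Tinv, Tmap, Qsq, Set.mem_prod, Set.mem_Ioo, Prod.mk.injEq]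
    generalize Real.sqrt ((x - y) ^ 2 + 4 * (1 - x - y)) = s at *
    refine ⟨⟨⟨?_, ?_⟩, ?_, ?_⟩, ?_, ?_⟩ <;> linarith
  have hB : ∀ q ∈ Qsq, Tinv (Tmap q) = q := by
    rintro ⟨a, b⟩ ⟨⟨ha, ha'⟩, hb, hb'⟩
    simp only at ha ha' hb hb'
    have hs : Real.sqrt (((1 + a) * (3 - b) / 8 - (3 - a) * (1 + b) / 8) ^ 2
        + 4 * (1 - (1 + a) * (3 - b) / 8 - (3 - a) * (1 + b) / 8)) = (2 - a - b) / 2 := by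
      rw [Real.sqrt_eq_iff_mul_self_eq_of_pos (by linarith)]
      ring
    simp only [Tinv, Tmap, Prod.mk.injEq, hs]
    constructor <;> ring
  have hC : Set.MapsTo Tmap Qsq Tri := by
    rintro ⟨a, b⟩ ⟨⟨ha, ha'⟩, hb, hb'⟩
    simp only at ha ha' hb hb'
    have h1 : 0 < (1 + a) * (3 - b) := mul_pos (by linarith) (by linarith)
    have h2 : 0 < (3 - a) * (1 + b) := mul_pos (by linarith) (by linarith)
    have h3 : 0 < (1 - a) * (1 - b) := mul_pos (by linarith) (by linarith)
    simp only [Tri, Tmap, Set.mem_setOf_eq]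
    refine ⟨by linarith, by linarith, by linarith⟩
  refine ⟨⟨hC, ?_, ?_⟩, hA, hB⟩
  · intro p hp q hq h
    rw [← hB p hp, h, hB q hq]
  · intro p hp
    exact ⟨Tinv p, (hA p hp).1, (hA p hp).2⟩
end
end

section
/- For every integer N ≥ 1, the tensor-product polynomial space 𝒬_N(𝐐) admits the direct sum decomposition 𝒬_N(𝐐) = (𝒫_N(𝐓) ∘ T) ⊕ χ · (𝒫_{N−1}(𝐓) ∘ T), where χ(ξ,η) = (2 − ξ − η)/2; that is, every q ∈ 𝒬_N(𝐐) can be written uniquely as q(ξ,η) = (p ∘ T)(ξ,η) + χ(ξ,η) · (p' ∘ T)(ξ,η) with p ∈ 𝒫_N(𝐓) and p' ∈ 𝒫_{N−1}(𝐓). -/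
noncomputable section

open Set

section

open MvPolynomial in
/-- Representability at level N. -/
def RepN (N : ℕ) (f : ℝ → ℝ → ℝ) : Prop :=
  ∃ A B : MvPolynomial (Fin 2) ℝ, A.totalDegree ≤ N ∧ (B = 0 ∨ B.totalDegree + 1 ≤ N) ∧
    ∀ a b : ℝ, f a b = eval ![(1 + a) * (3 - b) / 8, (3 - a) * (1 + b) / 8] A +
      (2 - a - b) / 2 * eval ![(1 + a) * (3 - b) / 8, (3 - a) * (1 + b) / 8] B

open MvPolynomial

theorem RepN.mono {N M : ℕ} {f : ℝ → ℝ → ℝ} (h : RepN N f) (hNM : N ≤ M) : RepN M f := by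
  obtain ⟨A, B, hA, hB, h⟩ := h
  exact ⟨A, B, hA.trans hNM, hB.imp id (fun h => h.trans hNM), h⟩

theorem RepN.add {N : ℕ} {f g : ℝ → ℝ → ℝ} (hf : RepN N f) (hg : RepN N g) :
    RepN N (fun a b => f a b + g a b) := by
  obtain ⟨A, B, hA, hB, h⟩ := hf
  obtain ⟨A', B', hA', hB', h'⟩ := hg
  refine ⟨A + A', B + B', (totalDegree_add _ _).trans (max_le hA hA'), ?_, ?_⟩
  · rcases hB with rfl | hB
    · simpa using hB'
    · rcases hB' with rfl | hB'
      · right; simpa using hB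
      · right
        have := totalDegree_add B B'
        omega
  · intro a b
    beta_reduce
    rw [h, h', map_add, map_add]; ring

theorem RepN.smul {N : ℕ} {f : ℝ → ℝ → ℝ} (c : ℝ) (hf : RepN N f) :
    RepN N (fun a b => c * f a b) := by
  obtain ⟨A, B, hA, hB, h⟩ := hf
  refine ⟨C c * A, C c * B, ?_, ?_, ?_⟩
  · have := totalDegree_mul (C c) A
    rw [totalDegree_C] at this
    omega
  · rcases hB with rfl | hB
    · left; simp
    · right
      have := totalDegree_mul (C c) B
      rw [totalDegree_C] at this
      omega
  · intro a b
    beta_reduce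
    rw [h, map_mul, map_mul, eval_C]; ring

theorem RepN.zero (N : ℕ) : RepN N (fun _ _ => 0) :=
  ⟨0, 0, by simp, Or.inl rfl, by simp⟩

theorem RepN.sum {ι : Type*} {N : ℕ} (s : Finset ι) (f : ι → ℝ → ℝ → ℝ)
    (h : ∀ i ∈ s, RepN N (f i)) : RepN N (fun a b => ∑ i ∈ s, f i a b) := by
  classical
  induction s using Finset.induction_on with
  | empty => simpa using RepN.zero N
  | insert i s hi ih =>
    simp only [Finset.sum_insert hi]
    exact (h i (by simp)).add (ih (fun j hj => h j (by simp [hj])))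

/-- multiplication by a linear polynomial -/
theorem lin_deg (N : ℕ) (d A : MvPolynomial (Fin 2) ℝ) (k : ℕ) (hd : d.totalDegree ≤ k)
    (hA : A.totalDegree ≤ N) : (d * A).totalDegree ≤ N + k := by
  have := totalDegree_mul d A
  omega

theorem degd : (X 0 - X 1 : MvPolynomial (Fin 2) ℝ).totalDegree ≤ 1 := by
  refine (totalDegree_sub _ _).trans ?_
  simp

theorem degs : (1 - X 0 - X 1 : MvPolynomial (Fin 2) ℝ).totalDegree ≤ 1 := by
  refine (totalDegree_sub _ _).trans (max_le ((totalDegree_sub _ _).trans ?_) ?_) <;> simp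

theorem degc : ((X 0 - X 1) * (X 0 - X 1) + C 4 * (1 - X 0 - X 1) :
    MvPolynomial (Fin 2) ℝ).totalDegree ≤ 2 := by
  refine (totalDegree_add _ _).trans (max_le (lin_deg 1 _ _ 1 degd degd) ?_)
  exact (lin_deg 1 _ _ 0 (by simp) degs).trans (by norm_num)

theorem RepN.mulw {N : ℕ} {f : ℝ → ℝ → ℝ} (e : ℝ) (hf : RepN N f) :
    RepN (N + 1) (fun a b => ((2 - a - b) / 2 + e * ((a - b) / 2)) * f a b) := by
  obtain ⟨A, B, hA, hB, h⟩ := hf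
  have key : ∀ p : MvPolynomial (Fin 2) ℝ, ∀ M, p.totalDegree ≤ M →
      (C e * ((X 0 - X 1) * p)).totalDegree ≤ M + 1 := fun p M hp =>
    lin_deg (M + 1) _ _ 0 (by simp) (lin_deg M _ _ 1 degd hp)
  refine ⟨((X 0 - X 1) * (X 0 - X 1) + C 4 * (1 - X 0 - X 1)) * B + C e * ((X 0 - X 1) * A),
    A + C e * ((X 0 - X 1) * B), ?_, Or.inr ?_, ?_⟩
  · refine (totalDegree_add _ _).trans (max_le ?_ (key A N hA))
    rcases hB with rfl | hB
    · simp
    · have := lin_deg _ _ B 2 degc le_rfl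
      omega
  · refine Nat.succ_le_succ ((totalDegree_add _ _).trans (max_le hA ?_))
    rcases hB with rfl | hB
    · simp
    · have := key B _ le_rfl
      omega
  · intro a b
    beta_reduce
    rw [h]
    simp only [map_add, map_mul, map_sub, eval_C, eval_X, map_one, Matrix.cons_val_zero,
      Matrix.cons_val_one]
    ring

theorem RepN.mulu {N : ℕ} {f : ℝ → ℝ → ℝ} (hf : RepN N f) :
    RepN (N + 1) (fun a b => (1 - a) * f a b) := by
  convert hf.mulw (-1) using 4; ring

theorem RepN.mulv {N : ℕ} {f : ℝ → ℝ → ℝ} (hf : RepN N f) :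
    RepN (N + 1) (fun a b => (1 - b) * f a b) := by
  convert hf.mulw 1 using 4; ring

theorem RepN.muluv {N : ℕ} {f : ℝ → ℝ → ℝ} (hf : RepN N f) :
    RepN (N + 1) (fun a b => (1 - a) * (1 - b) * f a b) := by
  obtain ⟨A, B, hA, hB, h⟩ := hf
  have key : ∀ p : MvPolynomial (Fin 2) ℝ, ∀ M, p.totalDegree ≤ M →
      (C 4 * ((1 - X 0 - X 1) * p)).totalDegree ≤ M + 1 := fun p M hp =>
    lin_deg (M + 1) _ _ 0 (by simp) (lin_deg M _ _ 1 degs hp)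
  refine ⟨C 4 * ((1 - X 0 - X 1) * A), C 4 * ((1 - X 0 - X 1) * B), key A N hA, ?_, ?_⟩
  · rcases hB with rfl | hB
    · left; simp
    · right
      have := key B _ le_rfl
      omega
  · intro a b
    beta_reduce
    rw [h]
    simp only [map_mul, map_sub, eval_C, eval_X, map_one, Matrix.cons_val_zero,
      Matrix.cons_val_one]
    ring

theorem repUV (N : ℕ) : ∀ i j : ℕ, i ≤ N → j ≤ N →
    RepN N (fun a b => (1 - a) ^ i * (1 - b) ^ j) := by
  induction N with
  | zero =>
    intro i j hi hj
    obtain rfl : i = 0 := by omega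
    obtain rfl : j = 0 := by omega
    exact ⟨1, 0, by simp, Or.inl rfl, by simp⟩
  | succ N ih =>
    intro i j hi hj
    rcases i with _ | i
    · rcases j with _ | j
      · exact (ih 0 0 (by omega) (by omega)).mono (by omega)
      · convert (ih 0 j (by omega) (by omega)).mulv using 3; ring
    · rcases j with _ | j
      · convert (ih i 0 (by omega) (by omega)).mulu using 3; ring
      · convert (ih i j (by omega) (by omega)).muluv using 3; ring

theorem repMon (N i j : ℕ) (hi : i ≤ N) (hj : j ≤ N) :
    RepN N (fun a b => a ^ i * b ^ j) := by
  have e : (fun a b : ℝ => a ^ i * b ^ j) = fun a b =>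
      ∑ k ∈ Finset.range (i + 1), ∑ l ∈ Finset.range (j + 1),
        ((-1 : ℝ) ^ k * (i.choose k : ℝ) * ((-1 : ℝ) ^ l * (j.choose l : ℝ))) * ((1 - a) ^ k * (1 - b) ^ l) := by
    have hp : ∀ (n : ℕ) (t : ℝ), t ^ n =
        ∑ k ∈ Finset.range (n + 1), (-1) ^ k * (n.choose k) * (1 - t) ^ k := by
      intro n t
      have := add_pow (-(1 - t)) 1 n
      rw [show -(1 - t) + 1 = t by ring] at this
      rw [this]
      refine Finset.sum_congr rfl fun k _ => ?_
      rw [neg_pow]; ring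
    funext a b
    rw [hp i a, hp j b, Finset.sum_mul_sum]
    refine Finset.sum_congr rfl fun k _ => Finset.sum_congr rfl fun l _ => ?_
    ring
  rw [e]
  refine RepN.sum _ _ fun k hk => RepN.sum _ _ fun l hl => RepN.smul _ (repUV N k l ?_ ?_)
  · have := Finset.mem_range.1 hk; omega
  · have := Finset.mem_range.1 hl; omega

theorem repQ (N : ℕ) (q : MvPolynomial (Fin 2) ℝ)
    (h0 : q.degreeOf 0 ≤ N) (h1 : q.degreeOf 1 ≤ N) :
    RepN N (fun a b => eval ![a, b] q) := by
  simp only [eval_eq', Fin.prod_univ_two, Matrix.cons_val_zero, Matrix.cons_val_one]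
  refine RepN.sum _ _ fun m hm => RepN.smul _ (repMon N _ _ ?_ ?_)
  · exact (monomial_le_degreeOf 0 hm).trans h0
  · exact (monomial_le_degreeOf 1 hm).trans h1

theorem zero_of_set (p : MvPolynomial (Fin 2) ℝ) (s : Set ℝ) (hs : s.Infinite)
    (h : ∀ a ∈ s, ∀ b ∈ s, eval ![a, b] p = 0) : p = 0 := by
  refine MvPolynomial.funext_set (fun _ => s) (fun _ => hs) fun x hx => ?_
  have e : x = ![x 0, x 1] := by ext i; fin_cases i <;> rfl
  rw [map_zero, e]
  exact h _ (hx 0 (Set.mem_univ _)) _ (hx 1 (Set.mem_univ _))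

theorem uniq (p r : MvPolynomial (Fin 2) ℝ)
    (h : ∀ a ∈ Ioo (-1 : ℝ) 1, ∀ b ∈ Ioo (-1 : ℝ) 1,
      eval ![(1 + a) * (3 - b) / 8, (3 - a) * (1 + b) / 8] p +
      (2 - a - b) / 2 * eval ![(1 + a) * (3 - b) / 8, (3 - a) * (1 + b) / 8] r = 0) :
    p = 0 ∧ r = 0 := by
  let t : Fin 2 → MvPolynomial (Fin 2) ℝ :=
    ![C (1 / 8) * ((1 + X 0) * (C 3 - X 1)), C (1 / 8) * ((C 3 - X 0) * (1 + X 1))]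
  have ht : ∀ a b : ℝ, ∀ w : MvPolynomial (Fin 2) ℝ, eval ![a, b] (bind₁ t w) =
      eval ![(1 + a) * (3 - b) / 8, (3 - a) * (1 + b) / 8] w := by
    intro a b w
    rw [← MvPolynomial.coe_aeval_eq_eval, ← MvPolynomial.coe_aeval_eq_eval]
    simp only [RingHom.coe_coe]
    rw [aeval_bind₁]
    congr 2
    funext i
    fin_cases i <;> simp [t] <;> ring
  let G := bind₁ t p + C (1 / 2) * (C 2 - X 0 - X 1) * bind₁ t r
  have hG' : ∀ a b, eval ![a, b] G =
      eval ![(1 + a) * (3 - b) / 8, (3 - a) * (1 + b) / 8] p +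
      (2 - a - b) / 2 * eval ![(1 + a) * (3 - b) / 8, (3 - a) * (1 + b) / 8] r := by
    intro a b
    simp only [G, map_add, map_mul, map_sub, eval_C, eval_X, Matrix.cons_val_zero,
      Matrix.cons_val_one, ht]
    ring
  have hG : G = 0 := zero_of_set G (Ioo (-1) 1) (Ioo_infinite (by norm_num))
    fun a ha b hb => (hG' a b).trans (h a ha b hb)
  have H : ∀ a b, eval ![(1 + a) * (3 - b) / 8, (3 - a) * (1 + b) / 8] p +
      (2 - a - b) / 2 * eval ![(1 + a) * (3 - b) / 8, (3 - a) * (1 + b) / 8] r = 0 := by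
    intro a b
    rw [← hG', hG, map_zero]
  have K : ∀ x ∈ Iic (0 : ℝ), ∀ y ∈ Iic (0 : ℝ), eval ![x, y] p = 0 ∧ eval ![x, y] r = 0 := by
    intro x hx y hy
    have hx : x ≤ 0 := hx
    have hy : y ≤ 0 := hy
    obtain ⟨c, hc0, hc⟩ : ∃ c : ℝ, 0 < c ∧ c * c = (x - y) ^ 2 + 4 * (1 - x - y) := by
      have hpos : 0 < (x - y) ^ 2 + 4 * (1 - x - y) := by nlinarith [sq_nonneg (x - y)]
      exact ⟨√_, Real.sqrt_pos.2 hpos, Real.mul_self_sqrt hpos.le⟩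
    have E : ∀ c : ℝ, c * c = (x - y) ^ 2 + 4 * (1 - x - y) →
        eval ![x, y] p + c * eval ![x, y] r = 0 := by
      intro c hc
      have := H (1 - (c - (x - y))) (1 - (c + (x - y)))
      rw [show (1 + (1 - (c - (x - y)))) * (3 - (1 - (c + (x - y)))) / 8 = x by linarith,
        show (3 - (1 - (c - (x - y)))) * (1 + (1 - (c + (x - y)))) / 8 = y by linarith,
        show (2 - (1 - (c - (x - y))) - (1 - (c + (x - y)))) / 2 = c by ring] at this
      exact this
    have e1 := E c hc
    have e2 := E (-c) (by linarith)
    refine ⟨by linarith, ?_⟩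
    have : c * eval ![x, y] r = 0 := by linarith
    exact (mul_eq_zero.1 this).resolve_left hc0.ne'
  exact ⟨zero_of_set p _ (Iic_infinite 0) fun x hx y hy => (K x hx y hy).1,
    zero_of_set r _ (Iic_infinite 0) fun x hx y hy => (K x hx y hy).2⟩

end

/-- The direct sum decomposition 𝒬_N(𝐐) = (𝒫_N(𝐓) ∘ T) ⊕ χ · (𝒫_{N−1}(𝐓) ∘ T),
where χ(ξ,η) = (2 − ξ − η)/2: every tensor-product polynomial q of degree ≤ N in each
variable can be written uniquely as q = p ∘ T + χ · (p' ∘ T) on 𝐐 with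
p of total degree ≤ N and p' of total degree ≤ N−1. -/
theorem tensor_poly_direct_sum (N : ℕ) (hN : 1 ≤ N) (q : MvPolynomial (Fin 2) ℝ)
    (h0 : q.degreeOf 0 ≤ N) (h1 : q.degreeOf 1 ≤ N) :
    ∃! pp : MvPolynomial (Fin 2) ℝ × MvPolynomial (Fin 2) ℝ,
      pp.1.totalDegree ≤ N ∧ pp.2.totalDegree ≤ N - 1 ∧
      ∀ z ∈ Qsq,
        MvPolynomial.eval ![z.1, z.2] q =
          MvPolynomial.eval ![(Tmap z).1, (Tmap z).2] pp.1 +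
            (2 - z.1 - z.2) / 2 * MvPolynomial.eval ![(Tmap z).1, (Tmap z).2] pp.2 := by
  obtain ⟨A, B, hA, hB, h⟩ := repQ N q h0 h1
  refine ⟨(A, B), ⟨hA, ?_, ?_⟩, ?_⟩
  · rcases hB with rfl | hB
    · simp
    · show B.totalDegree ≤ N - 1
      omega
  · intro z _
    exact h z.1 z.2
  · rintro ⟨A', B'⟩ ⟨-, -, h'⟩
    have := uniq (A' - A) (B' - B) (by
      intro a ha b hb
      have e1 := h a b
      have e2 := h' (a, b) ⟨ha, hb⟩
      simp only [Tmap] at e1 e2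
      rw [map_sub, map_sub]
      linarith)
    rw [sub_eq_zero.1 this.1, sub_eq_zero.1 this.2]
end
end

section
/- Let u be a real-valued function that is differentiable on the triangle 𝐓 and set ũ = u ∘ T. Then for every (ξ,η) ∈ 𝐐, writing (x,y) = T(ξ,η) and χ = (2−ξ−η)/2, the gradient of u satisfies ∂u/∂x (x,y) = χ⁻¹ [ 2(∂_ξ ũ + ∂_η ũ) + ((1−ξ)∂_ξ ũ − (1−η)∂_η ũ) ] and ∂u/∂y (x,y) = χ⁻¹ [ 2(∂_ξ ũ + ∂_η ũ) − ((1−ξ)∂_ξ ũ − (1−η)∂_η ũ) ], where all ξ,η-derivatives are evaluated at (ξ,η). -/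
noncomputable section

open Set

/-- Gradient transformation formula: if u is differentiable on 𝐓 and ũ = u ∘ T, then for
(ξ,η) ∈ 𝐐, with χ = (2−ξ−η)/2,
∂u/∂x = χ⁻¹[2(∂_ξũ + ∂_ηũ) + ((1−ξ)∂_ξũ − (1−η)∂_ηũ)] and
∂u/∂y = χ⁻¹[2(∂_ξũ + ∂_ηũ) − ((1−ξ)∂_ξũ − (1−η)∂_ηũ)]. -/
theorem gradient_transform (u : ℝ × ℝ → ℝ)
    (hu : ∀ p ∈ Tri, DifferentiableAt ℝ u p) :
    ∀ z ∈ Qsq,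
      fderiv ℝ u (Tmap z) (1, 0) =
        ((2 - z.1 - z.2) / 2)⁻¹ *
          (2 * (fderiv ℝ (u ∘ Tmap) z (1, 0) + fderiv ℝ (u ∘ Tmap) z (0, 1)) +
            ((1 - z.1) * fderiv ℝ (u ∘ Tmap) z (1, 0) -
              (1 - z.2) * fderiv ℝ (u ∘ Tmap) z (0, 1))) ∧
      fderiv ℝ u (Tmap z) (0, 1) =
        ((2 - z.1 - z.2) / 2)⁻¹ *
          (2 * (fderiv ℝ (u ∘ Tmap) z (1, 0) + fderiv ℝ (u ∘ Tmap) z (0, 1)) -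
            ((1 - z.1) * fderiv ℝ (u ∘ Tmap) z (1, 0) -
              (1 - z.2) * fderiv ℝ (u ∘ Tmap) z (0, 1))) := by
  rintro ⟨a, b⟩ ⟨⟨ha1, ha2⟩, ⟨hb1, hb2⟩⟩
  simp only at ha1 ha2 hb1 hb2
  have hmem : Tmap (a, b) ∈ Tri := by
    refine ⟨?_, ?_, ?_⟩
    · simp only [Tmap]
      have := mul_pos (show 0 < 1 + a by linarith) (show 0 < 3 - b by linarith)
      linarith
    · simp only [Tmap]
      have := mul_pos (show 0 < 3 - a by linarith) (show 0 < 1 + b by linarith)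
      linarith
    · simp only [Tmap]
      have := mul_pos (show 0 < 1 - a by linarith) (show 0 < 1 - b by linarith)
      nlinarith
  have h1 : HasFDerivAt (fun q : ℝ × ℝ => q.1) (ContinuousLinearMap.fst ℝ ℝ ℝ) (a, b) :=
    hasFDerivAt_fst
  have h2 : HasFDerivAt (fun q : ℝ × ℝ => q.2) (ContinuousLinearMap.snd ℝ ℝ ℝ) (a, b) :=
    hasFDerivAt_snd
  have hX := ((h1.const_add 1).mul (h2.const_sub 3)).mul_const (8⁻¹ : ℝ)
  have hY := ((h1.const_sub 3).mul (h2.const_add 1)).mul_const (8⁻¹ : ℝ)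
  have hT : HasFDerivAt Tmap _ (a, b) := hX.prodMk hY
  have hc := ((hu _ hmem).hasFDerivAt.comp (a, b) hT).fderiv
  have hlin : ∀ s t : ℝ, fderiv ℝ u (Tmap (a, b)) (s, t) =
      s * fderiv ℝ u (Tmap (a, b)) (1, 0) + t * fderiv ℝ u (Tmap (a, b)) (0, 1) := by
    intro s t
    rw [← smul_eq_mul, ← smul_eq_mul, ← map_smul, ← map_smul, ← map_add]
    simp
  have e1 : fderiv ℝ (u ∘ Tmap) (a, b) (1, 0) =
      (3 - b) / 8 * fderiv ℝ u (Tmap (a, b)) (1, 0)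
        + (-(1 + b) / 8) * fderiv ℝ u (Tmap (a, b)) (0, 1) := by
    rw [hc, ← hlin, ContinuousLinearMap.comp_apply]
    congr 1
    ext <;> simp <;> ring
  have e2 : fderiv ℝ (u ∘ Tmap) (a, b) (0, 1) =
      (-(1 + a) / 8) * fderiv ℝ u (Tmap (a, b)) (1, 0)
        + (3 - a) / 8 * fderiv ℝ u (Tmap (a, b)) (0, 1) := by
    rw [hc, ← hlin, ContinuousLinearMap.comp_apply]
    congr 1
    ext <;> simp <;> ring
  rw [e1, e2]
  have hne : (2 - a - b) / 2 ≠ 0 := by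
    have : 0 < 2 - a - b := by linarith
    positivity
  constructor
  · rw [eq_inv_mul_iff_mul_eq₀ hne]
    simp only
    ring
  · rw [eq_inv_mul_iff_mul_eq₀ hne]
    simp only
    ring
end
end

section
/- Let u and v be continuously differentiable real-valued functions on (a neighborhood of the closure of) the triangle 𝐓, and set ũ = u ∘ T, ṽ = v ∘ T. Then ∬_𝐓 ∇u · ∇v dx dy = ∬_𝐐 (∂_ξ ũ + ∂_η ũ)(∂_ξ ṽ + ∂_η ṽ) χ⁻¹ dξ dη + (1/4) ∬_𝐐 ((1−ξ)∂_ξ ũ − (1−η)∂_η ũ)((1−ξ)∂_ξ ṽ − (1−η)∂_η ṽ) χ⁻¹ dξ dη, where χ = (2−ξ−η)/2. -/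
noncomputable section

open Set MeasureTheory

def TD (z : ℝ × ℝ) : ℝ × ℝ →L[ℝ] ℝ × ℝ :=
  LinearMap.toContinuousLinearMap (Matrix.toLin (Module.Basis.finTwoProd ℝ) (Module.Basis.finTwoProd ℝ)
    !![(3 - z.2) / 8, -(1 + z.1) / 8; -(1 + z.2) / 8, (3 - z.1) / 8])

lemma TD_det (z : ℝ × ℝ) : (TD z).det = (2 - z.1 - z.2) / 16 := by
  simp only [TD, LinearMap.det_toContinuousLinearMap, LinearMap.det_toLin, Matrix.det_fin_two_of]
  ring

lemma TD_apply (z w : ℝ × ℝ) : TD z w =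
    ((3 - z.2) / 8 * w.1 + -(1 + z.1) / 8 * w.2, -(1 + z.2) / 8 * w.1 + (3 - z.1) / 8 * w.2) := by
  simp [TD, Matrix.toLin_finTwoProd_apply]

lemma hasFDeriv_T (z : ℝ × ℝ) : HasFDerivAt Tmap (TD z) z := by
  have h1 : HasFDerivAt (fun q : ℝ × ℝ => q.1) (ContinuousLinearMap.fst ℝ ℝ ℝ) z := hasFDerivAt_fst
  have h2 : HasFDerivAt (fun q : ℝ × ℝ => q.2) (ContinuousLinearMap.snd ℝ ℝ ℝ) z := hasFDerivAt_snd
  have h := (((h1.const_add 1).mul (h2.const_sub 3)).mul_const (1/8 : ℝ)).prodMk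
    (((h1.const_sub 3).mul (h2.const_add 1)).mul_const (1/8 : ℝ))
  have e : Tmap = fun q : ℝ × ℝ => ((1 + q.1) * (3 - q.2) * (1/8), (3 - q.1) * (1 + q.2) * (1/8)) := by
    funext q; simp [Tmap, div_eq_mul_inv]
  rw [e]
  refine h.congr_fderiv ?_
  ext w <;> simp [TD_apply] <;> ring

lemma T_inj : InjOn Tmap Qsq := by
  rintro ⟨a, b⟩ ⟨⟨_, ha⟩, ⟨_, hb⟩⟩ ⟨c, d⟩ ⟨⟨_, hc⟩, ⟨_, hd⟩⟩ h
  simp only [Tmap, Prod.mk.injEq] at h ha hb hc hd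
  obtain ⟨h1, h2⟩ := h
  have e1 : b = a - c + d := by linarith
  subst e1
  have : (a - c) * (2 - a - d) = 0 := by linarith
  rcases mul_eq_zero.1 this with h | h
  · have : a = c := by linarith
    subst this; simp
  · exfalso; linarith

lemma T_image : Tmap '' Qsq = Tri := by
  ext ⟨x, y⟩
  constructor
  · rintro ⟨⟨a, b⟩, ⟨⟨ha', ha⟩, ⟨hb', hb⟩⟩, h⟩
    simp only [Tmap, Prod.mk.injEq] at h ha hb ha' hb'
    obtain ⟨rfl, rfl⟩ := h
    refine ⟨?_, ?_, ?_⟩ <;> dsimp only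
    · have := mul_pos (show 0 < 1 + a by linarith) (show 0 < 3 - b by linarith)
      linarith
    · have := mul_pos (show 0 < 3 - a by linarith) (show 0 < 1 + b by linarith)
      linarith
    · have := mul_pos (show 0 < 1 - a by linarith) (show 0 < 1 - b by linarith)
      nlinarith
  · rintro ⟨hx, hy, hxy⟩
    dsimp only at hx hy hxy
    have hp : 0 < 16 + 4 * (x - y) ^ 2 - 16 * (x + y) := by nlinarith [sq_nonneg (x - y)]
    obtain ⟨r, hr, hr2⟩ : ∃ r : ℝ, 0 < r ∧ r ^ 2 = 16 + 4 * (x - y) ^ 2 - 16 * (x + y) :=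
      ⟨_, Real.sqrt_pos.2 hp, Real.sq_sqrt hp.le⟩
    have k1 : 2 * (x - y) < r := by
      apply lt_of_pow_lt_pow_left₀ 2 hr.le; nlinarith
    have k2 : -(2 * (x - y)) < r := by
      apply lt_of_pow_lt_pow_left₀ 2 hr.le; nlinarith
    have k3 : r < 4 + 2 * (x - y) := by
      apply lt_of_pow_lt_pow_left₀ 2 (by linarith); nlinarith
    have k4 : r < 4 - 2 * (x - y) := by
      apply lt_of_pow_lt_pow_left₀ 2 (by linarith); nlinarith
    refine ⟨((2 - r + 2 * (x - y)) / 2, (2 - r - 2 * (x - y)) / 2), ⟨⟨?_, ?_⟩, ⟨?_, ?_⟩⟩, ?_⟩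
    · dsimp only; linarith
    · dsimp only; linarith
    · dsimp only; linarith
    · dsimp only; linarith
    · simp only [Tmap, Prod.mk.injEq]
      constructor <;> linarith

lemma T_cont : Continuous Tmap := by unfold Tmap; fun_prop

lemma pair_apply (L : ℝ × ℝ →L[ℝ] ℝ) (a b : ℝ) : L (a, b) = a * L (1, 0) + b * L (0, 1) := by
  have : ((a, b) : ℝ × ℝ) = a • ((1, 0) : ℝ × ℝ) + b • ((0, 1) : ℝ × ℝ) := by simp
  rw [this, map_add, map_smul, map_smul]; simp

/-- Transformation of the Dirichlet bilinear form: for u, v continuously differentiable on a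
neighborhood of the closure of 𝐓, writing ũ = u ∘ T, ṽ = v ∘ T and χ = (2−ξ−η)/2,
∬_𝐓 ∇u·∇v = ∬_𝐐 (∂_ξũ+∂_ηũ)(∂_ξṽ+∂_ηṽ) χ⁻¹
  + (1/4) ∬_𝐐 ((1−ξ)∂_ξũ−(1−η)∂_ηũ)((1−ξ)∂_ξṽ−(1−η)∂_ηṽ) χ⁻¹. -/
theorem dirichlet_form_transform (u v : ℝ × ℝ → ℝ) (U : Set (ℝ × ℝ))
    (hU : IsOpen U) (hTU : closure Tri ⊆ U)
    (hu : ContDiffOn ℝ 1 u U) (hv : ContDiffOn ℝ 1 v U) :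
    ∫ p in Tri,
        (fderiv ℝ u p (1, 0) * fderiv ℝ v p (1, 0) +
          fderiv ℝ u p (0, 1) * fderiv ℝ v p (0, 1)) =
      (∫ z in Qsq,
          (fderiv ℝ (u ∘ Tmap) z (1, 0) + fderiv ℝ (u ∘ Tmap) z (0, 1)) *
            (fderiv ℝ (v ∘ Tmap) z (1, 0) + fderiv ℝ (v ∘ Tmap) z (0, 1)) *
              ((2 - z.1 - z.2) / 2)⁻¹) +
        (1 / 4) *
          ∫ z in Qsq,
            ((1 - z.1) * fderiv ℝ (u ∘ Tmap) z (1, 0) -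
              (1 - z.2) * fderiv ℝ (u ∘ Tmap) z (0, 1)) *
              ((1 - z.1) * fderiv ℝ (v ∘ Tmap) z (1, 0) -
                (1 - z.2) * fderiv ℝ (v ∘ Tmap) z (0, 1)) *
                ((2 - z.1 - z.2) / 2)⁻¹ := by
  have hmem : ∀ z ∈ closure Qsq, Tmap z ∈ U := fun z hz => hTU <| by
    rw [← T_image]
    exact image_closure_subset_closure_image T_cont (mem_image_of_mem _ hz)
  have hcpt : IsCompact (closure Qsq) := by
    rw [Qsq, closure_prod_eq, closure_Ioo (by norm_num)]
    exact isCompact_Icc.prod isCompact_Icc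
  have hQm : MeasurableSet Qsq := measurableSet_Ioo.prod measurableSet_Ioo
  have hcd : ∀ w : ℝ × ℝ → ℝ, ContDiffOn ℝ 1 w U → ∀ e : ℝ × ℝ,
      ContinuousOn (fun z => fderiv ℝ w (Tmap z) e) (closure Qsq) := fun w hw e =>
    ((hw.continuousOn_fderiv_of_isOpen hU le_rfl).comp T_cont.continuousOn hmem).clm_apply
      continuousOn_const
  have hch : ∀ w : ℝ × ℝ → ℝ, ContDiffOn ℝ 1 w U → ∀ z ∈ Qsq,
      fderiv ℝ (w ∘ Tmap) z (1, 0) = (3 - z.2) / 8 * fderiv ℝ w (Tmap z) (1, 0)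
          + -(1 + z.2) / 8 * fderiv ℝ w (Tmap z) (0, 1) ∧
      fderiv ℝ (w ∘ Tmap) z (0, 1) = -(1 + z.1) / 8 * fderiv ℝ w (Tmap z) (1, 0)
          + (3 - z.1) / 8 * fderiv ℝ w (Tmap z) (0, 1) := by
    intro w hw z hz
    have hd : DifferentiableAt ℝ w (Tmap z) :=
      (hw.differentiableOn one_ne_zero).differentiableAt (hU.mem_nhds (hmem z (subset_closure hz)))
    have := (hd.hasFDerivAt.comp z (hasFDeriv_T z)).fderiv
    rw [this]
    constructor
    · rw [ContinuousLinearMap.comp_apply, TD_apply, pair_apply]; simp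
    · rw [ContinuousLinearMap.comp_apply, TD_apply, pair_apply]; simp
  have u1 := hcd u hu (1, 0)
  have u2 := hcd u hu (0, 1)
  have v1 := hcd v hv (1, 0)
  have v2 := hcd v hv (0, 1)
  have hpos : ∀ z ∈ Qsq, 0 < 2 - z.1 - z.2 := by
    rintro z ⟨⟨_, h1⟩, ⟨_, h2⟩⟩; linarith
  rw [setIntegral_congr_fun (g := fun z =>
      (fderiv ℝ u (Tmap z) (1, 0) + fderiv ℝ u (Tmap z) (0, 1)) *
      (fderiv ℝ v (Tmap z) (1, 0) + fderiv ℝ v (Tmap z) (0, 1)) * ((2 - z.1 - z.2) / 32)) hQm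
      (μ := volume) (f := fun z => (fderiv ℝ (u ∘ Tmap) z (1, 0) + fderiv ℝ (u ∘ Tmap) z (0, 1)) *
            (fderiv ℝ (v ∘ Tmap) z (1, 0) + fderiv ℝ (v ∘ Tmap) z (0, 1)) *
              ((2 - z.1 - z.2) / 2)⁻¹),
    setIntegral_congr_fun (g := fun z =>
      (fderiv ℝ u (Tmap z) (1, 0) - fderiv ℝ u (Tmap z) (0, 1)) *
      (fderiv ℝ v (Tmap z) (1, 0) - fderiv ℝ v (Tmap z) (0, 1)) * ((2 - z.1 - z.2) / 8)) hQm
      (μ := volume) (f := fun z => ((1 - z.1) * fderiv ℝ (u ∘ Tmap) z (1, 0) -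
              (1 - z.2) * fderiv ℝ (u ∘ Tmap) z (0, 1)) *
              ((1 - z.1) * fderiv ℝ (v ∘ Tmap) z (1, 0) -
                (1 - z.2) * fderiv ℝ (v ∘ Tmap) z (0, 1)) *
                ((2 - z.1 - z.2) / 2)⁻¹),
    ← integral_const_mul, ← integral_add, ← T_image,
    integral_image_eq_integral_abs_det_fderiv_smul volume hQm
      (fun z _ => (hasFDeriv_T z).hasFDerivWithinAt) T_inj]
  · refine setIntegral_congr_fun hQm fun z hz => ?_
    have := hpos z hz
    simp only [TD_det, smul_eq_mul]
    rw [abs_of_pos (by linarith)]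
    ring
  · refine (ContinuousOn.integrableOn_compact hcpt ?_).mono_set subset_closure
    fun_prop
  · refine (ContinuousOn.integrableOn_compact hcpt ?_).mono_set subset_closure
    fun_prop
  · intro z hz
    have h := hpos z hz
    dsimp only
    rw [(hch u hu z hz).1, (hch u hu z hz).2, (hch v hv z hz).1, (hch v hv z hz).2]
    have := h.ne'
    field_simp
    ring
  · intro z hz
    have h := hpos z hz
    dsimp only
    rw [(hch u hu z hz).1, (hch u hu z hz).2, (hch v hv z hz).1, (hch v hv z hz).2]
    have := h.ne'
    field_simp
    ring
end
end
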